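/- Let G be a weak near-triangulation and let u be a problematic external vertex of G. Let T be the set of all u-bad vertices of G. Then G−({u} ∪ T) is a weak near-triangulation. -/

import Mathlib

open Set

/-- A plane graph: a finite simple graph whose vertices are points of the plane,
together with a plane embedding in which every edge is drawn as an arc (the range of an
injective path) joining its endpoints, two arcs meet only in common endpoints, and
no vertex lies on an arc other than at its endpoints. -/
structure PlaneGraph where
  verts : Set (ℝ × ℝ)
  finite_verts : verts.Finite
  Adj : (ℝ × ℝ) → (ℝ × ℝ) → Prop
  adj_symm : ∀ u v, Adj u v → Adj v u
  adj_irrefl : ∀ v, ¬ Adj v v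
  adj_mem : ∀ u v, Adj u v → u ∈ verts
  arc : (ℝ × ℝ) → (ℝ × ℝ) → Set (ℝ × ℝ)
  arc_symm : ∀ u v, arc u v = arc v u
  arc_path : ∀ u v, Adj u v → ∃ γ : Path u v, Function.Injective ⇑γ ∧ arc u v = Set.range ⇑γ
  arc_verts : ∀ u v, Adj u v → verts ∩ arc u v ⊆ {u, v}
  arc_inter : ∀ u v u' v', Adj u v → Adj u' v' → ({u, v} : Set (ℝ × ℝ)) ≠ {u', v'} →
    arc u v ∩ arc u' v' ⊆ ({u, v} : Set (ℝ × ℝ)) ∩ {u', v'}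

namespace PlaneGraph

/-- The plane subgraph induced on a set of vertices, with the inherited embedding. -/
def induce (G : PlaneGraph) (S : Set (ℝ × ℝ)) : PlaneGraph where
  verts := G.verts ∩ S
  finite_verts := G.finite_verts.subset inter_subset_left
  Adj u v := G.Adj u v ∧ u ∈ S ∧ v ∈ S
  adj_symm _ _ h := ⟨G.adj_symm _ _ h.1, h.2.2, h.2.1⟩
  adj_irrefl v h := G.adj_irrefl v h.1
  adj_mem _ _ h := ⟨G.adj_mem _ _ h.1, h.2.1⟩
  arc := G.arc
  arc_symm := G.arc_symm
  arc_path _ _ h := G.arc_path _ _ h.1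
  arc_verts _ _ h := fun _ hx => G.arc_verts _ _ h.1 ⟨hx.1.1, hx.2⟩
  arc_inter _ _ _ _ h h' hne := G.arc_inter _ _ _ _ h.1 h'.1 hne

/-- Deleting a set of vertices (together with all incident edges),
keeping the inherited embedding. -/
def delete (G : PlaneGraph) (X : Set (ℝ × ℝ)) : PlaneGraph := G.induce Xᶜ

/-- Deleting a single vertex. -/
def erase (G : PlaneGraph) (x : ℝ × ℝ) : PlaneGraph := G.delete {x}

/-- The point set of the plane drawing of `G`. -/
def drawing (G : PlaneGraph) : Set (ℝ × ℝ) :=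
  G.verts ∪ ⋃ (u) (v) (_ : G.Adj u v), G.arc u v

/-- The faces of `G`: connected components of the complement of the drawing. -/
def IsFace (G : PlaneGraph) (F : Set (ℝ × ℝ)) : Prop :=
  ∃ x, x ∉ G.drawing ∧ F = connectedComponentIn G.drawingᶜ x

/-- A vertex is external if it is incident to (i.e. lies on the boundary of)
an unbounded face. -/
def ExternalVertex (G : PlaneGraph) (v : ℝ × ℝ) : Prop :=
  v ∈ G.verts ∧ ∃ F, G.IsFace F ∧ ¬ Bornology.IsBounded F ∧ v ∈ closure F

/-- A triangle (cycle on three vertices) of `G`. -/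
def IsTriangle (G : PlaneGraph) (a b c : ℝ × ℝ) : Prop :=
  a ≠ b ∧ a ≠ c ∧ b ≠ c ∧ G.Adj a b ∧ G.Adj b c ∧ G.Adj a c

/-- `v` is contained in a triangle of `G`. -/
def InTriangle (G : PlaneGraph) (v : ℝ × ℝ) : Prop := ∃ b c, G.IsTriangle v b c

/-- The drawing of the closed curve formed by a triangle on `a`, `b`, `c`. -/
def triDrawing (G : PlaneGraph) (a b c : ℝ × ℝ) : Set (ℝ × ℝ) :=
  G.arc a b ∪ G.arc b c ∪ G.arc a c

/-- A face is triangular if its boundary is the drawing of a triangle of `G`. -/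
def IsTriangularFace (G : PlaneGraph) (F : Set (ℝ × ℝ)) : Prop :=
  ∃ a b c, G.IsTriangle a b c ∧ frontier F = G.triDrawing a b c

/-- The interior region of the closed curve drawn by a triangle: the union of the
bounded connected components of the complement of its drawing. -/
def triangleInterior (G : PlaneGraph) (a b c : ℝ × ℝ) : Set (ℝ × ℝ) :=
  {x | x ∉ G.triDrawing a b c ∧
    Bornology.IsBounded (connectedComponentIn (G.triDrawing a b c)ᶜ x)}

/-- A facial triangle: a triangle whose interior region is a face of `G`. -/
def IsFacialTriangle (G : PlaneGraph) (a b c : ℝ × ℝ) : Prop :=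
  G.IsTriangle a b c ∧ G.IsFace (G.triangleInterior a b c)

/-- A weak near-triangulation: every bounded face is triangular and every vertex
is contained in a triangle. -/
def IsWNT (G : PlaneGraph) : Prop :=
  (∀ F, G.IsFace F → Bornology.IsBounded F → G.IsTriangularFace F) ∧
  ∀ v ∈ G.verts, G.InTriangle v

/-- Reachability by walks in `G`. -/
def Reachable (G : PlaneGraph) (u v : ℝ × ℝ) : Prop := Relation.ReflTransGen G.Adj u v

/-- Connectedness of `G`. -/
def Connected (G : PlaneGraph) : Prop :=
  G.verts.Nonempty ∧ ∀ u ∈ G.verts, ∀ v ∈ G.verts, G.Reachable u v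

/-- A cutvertex: a vertex whose deletion separates two other vertices. -/
def IsCutvertex (G : PlaneGraph) (v : ℝ × ℝ) : Prop :=
  v ∈ G.verts ∧ ∃ a b, a ∈ G.verts ∧ b ∈ G.verts ∧ a ≠ v ∧ b ≠ v ∧
    G.Reachable a b ∧ ¬ (G.erase v).Reachable a b

/-- 2-connectivity: connected, on at least three vertices, with no cutvertex. -/
def TwoConnected (G : PlaneGraph) : Prop :=
  G.Connected ∧ 3 ≤ G.verts.ncard ∧ ∀ v, ¬ G.IsCutvertex v

/-- A near-triangulation: a 2-connected plane graph all of whose bounded faces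
are triangular. -/
def IsNearTriangulation (G : PlaneGraph) : Prop :=
  G.TwoConnected ∧ ∀ F, G.IsFace F → Bornology.IsBounded F → G.IsTriangularFace F

/-- A plane triangulation: a connected plane graph all of whose faces (including
the unbounded one) are triangular. -/
def IsTriangulation (G : PlaneGraph) : Prop :=
  G.Connected ∧ ∀ F, G.IsFace F → G.IsTriangularFace F

/-- A block of `G`, given by its vertex set `B`: a maximal set of vertices inducing
a connected subgraph without a cutvertex. -/
def IsBlock (G : PlaneGraph) (B : Set (ℝ × ℝ)) : Prop :=
  B ⊆ G.verts ∧ (G.induce B).Connected ∧ (∀ v, ¬ (G.induce B).IsCutvertex v) ∧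
  ∀ B', B ⊆ B' → B' ⊆ G.verts → (G.induce B').Connected →
    (∀ v, ¬ (G.induce B').IsCutvertex v) → B' = B

/-- A plane graph is outerplanar if all of its vertices are incident to the
unbounded face. -/
def IsOuterplanar (G : PlaneGraph) : Prop := ∀ v ∈ G.verts, G.ExternalVertex v

/-- A dominating set of `G`. -/
def IsDominatingSet (G : PlaneGraph) (D : Set (ℝ × ℝ)) : Prop :=
  D ⊆ G.verts ∧ ∀ v ∈ G.verts, v ∉ D → ∃ d ∈ D, G.Adj v d

/-- The domination number of `G`. -/
noncomputable def dominationNumber (G : PlaneGraph) : ℕ :=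
  sInf {n | ∃ D, G.IsDominatingSet D ∧ D.ncard = n}

/-- `u` is problematic in `G` if `G − u` is not a weak near-triangulation. -/
def Problematic (G : PlaneGraph) (u : ℝ × ℝ) : Prop := ¬ (G.erase u).IsWNT

/-- `x` is a `u`-bad vertex in `G`: a vertex of `G − u` not contained in a triangle
of `G − u`. -/
def IsBadFor (G : PlaneGraph) (u x : ℝ × ℝ) : Prop :=
  x ∈ G.verts ∧ x ≠ u ∧ ¬ (G.erase u).InTriangle x

end PlaneGraph

namespace PlaneGraph

variable {G : PlaneGraph} {S : Set (ℝ × ℝ)} {a b c u v x y : ℝ × ℝ}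

lemma verts_subset_drawing : G.verts ⊆ G.drawing := subset_union_left

lemma arc_subset_drawing (h : G.Adj x y) : G.arc x y ⊆ G.drawing := fun _ hp =>
  Or.inr (mem_iUnion.2 ⟨x, mem_iUnion.2 ⟨y, mem_iUnion.2 ⟨h, hp⟩⟩⟩)

lemma mem_drawing_iff {p : ℝ × ℝ} :
    p ∈ G.drawing ↔ p ∈ G.verts ∨ ∃ x y, G.Adj x y ∧ p ∈ G.arc x y := by
  simp [drawing]

lemma left_mem_arc (h : G.Adj x y) : x ∈ G.arc x y := by
  obtain ⟨γ, -, hγ⟩ := G.arc_path x y h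
  exact hγ ▸ ⟨0, γ.source⟩

lemma right_mem_arc (h : G.Adj x y) : y ∈ G.arc x y :=
  G.arc_symm y x ▸ left_mem_arc (G.adj_symm x y h)

lemma isPreconnected_arc (h : G.Adj x y) : IsPreconnected (G.arc x y) := by
  obtain ⟨γ, -, hγ⟩ := G.arc_path x y h
  exact hγ ▸ isPreconnected_range γ.continuous

lemma isPreconnected_arc_diff_right (h : G.Adj x y) : IsPreconnected (G.arc x y \ {y}) := by
  obtain ⟨γ, hinj, hγ⟩ := G.arc_path x y h
  have : G.arc x y \ {y} = γ '' Iio 1 := by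
    ext p
    simp only [hγ, mem_sdiff, mem_range, mem_singleton_iff, mem_image, mem_Iio]
    constructor
    · rintro ⟨⟨t, rfl⟩, ht⟩
      refine ⟨t, lt_of_le_of_ne unitInterval.le_one' ?_, rfl⟩
      rintro rfl
      exact ht γ.target
    · rintro ⟨t, ht, rfl⟩
      exact ⟨⟨t, rfl⟩, fun hy => ht.ne (hinj (hy.trans γ.target.symm))⟩
  rw [this]
  exact isPreconnected_Iio.image γ γ.continuous.continuousOn

lemma isClosed_drawing (G : PlaneGraph) : IsClosed G.drawing := by
  have h : G.drawing = G.verts ∪ ⋃ e ∈ {e ∈ G.verts ×ˢ G.verts | G.Adj e.1 e.2},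
      G.arc e.1 e.2 := by
    ext p
    rw [mem_drawing_iff, mem_union, mem_iUnion₂]
    refine or_congr_right ⟨?_, fun ⟨e, he, hp⟩ => ⟨e.1, e.2, he.2, hp⟩⟩
    rintro ⟨x, y, h, hp⟩
    exact ⟨(x, y), ⟨⟨G.adj_mem x y h, G.adj_mem y x (G.adj_symm x y h)⟩, h⟩, hp⟩
  rw [h]
  refine G.finite_verts.isClosed.union
    (((G.finite_verts.prod G.finite_verts).subset (sep_subset _ _)).isClosed_biUnion ?_)
  rintro ⟨x, y⟩ ⟨-, hxy⟩
  obtain ⟨γ, -, hγ⟩ := G.arc_path x y hxy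
  exact hγ ▸ (isCompact_range γ.continuous).isClosed

lemma drawing_induce_subset : (G.induce S).drawing ⊆ G.drawing := by
  intro p hp
  obtain hp | ⟨x, y, h, hp⟩ := mem_drawing_iff.1 hp
  · exact verts_subset_drawing hp.1
  · exact arc_subset_drawing h.1 hp

/-- A vertex of `G` on the drawing of an induced subgraph is a vertex of that subgraph. -/
lemma mem_of_mem_drawing_induce (hv : v ∈ G.verts) (h : v ∈ (G.induce S).drawing) : v ∈ S := by
  obtain h | ⟨x, y, hxy, h⟩ := mem_drawing_iff.1 h
  · exact h.2
  · obtain rfl | rfl := G.arc_verts x y hxy.1 ⟨hv, h⟩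
    exacts [hxy.2.1, hxy.2.2]

/-- An arc at a deleted vertex meets the remaining drawing at most in its other endpoint. -/
lemma eq_right_of_mem_arc_of_mem_drawing_induce (h : G.Adj x y) (hx : x ∉ S) {p : ℝ × ℝ}
    (hp : p ∈ G.arc x y) (hpS : p ∈ (G.induce S).drawing) : p = y ∧ y ∈ S := by
  have key : p ∈ ({x, y} : Set (ℝ × ℝ)) := by
    obtain hv | ⟨z, w, hzw, hpa⟩ := mem_drawing_iff.1 hpS
    · exact G.arc_verts x y h ⟨hv.1, hp⟩
    · refine (G.arc_inter x y z w h hzw.1 (fun heq => ?_) ⟨hp, hpa⟩).1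
      obtain rfl | rfl : x ∈ ({z, w} : Set (ℝ × ℝ)) := heq ▸ mem_insert x {y}
      exacts [hx hzw.2.1, hx hzw.2.2]
  obtain rfl | rfl := key
  · exact absurd (mem_of_mem_drawing_induce (G.adj_mem _ _ h) hpS) hx
  · exact ⟨rfl, mem_of_mem_drawing_induce (G.adj_mem _ _ (G.adj_symm _ _ h)) hpS⟩

/-- If all deleted vertices lie in one face `C` of an induced subgraph, then everything
deleted from the drawing lies in `C`. -/
lemma drawing_subset_union_face {q : ℝ × ℝ}
    (hS : ∀ x ∈ G.verts, x ∉ S → x ∈ connectedComponentIn (G.induce S).drawingᶜ q) :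
    G.drawing ⊆ (G.induce S).drawing ∪ connectedComponentIn (G.induce S).drawingᶜ q := by
  have key : ∀ x y p, G.Adj x y → x ∉ S → p ∈ G.arc x y →
      p ∈ (G.induce S).drawing ∪ connectedComponentIn (G.induce S).drawingᶜ q := by
    intro x y p h hx hp
    have hxC := hS x (G.adj_mem x y h) hx
    have hxy : x ≠ y := fun e => G.adj_irrefl x (e ▸ h)
    by_cases hpy : p = y
    · subst hpy
      have hpv := G.adj_mem _ _ (G.adj_symm _ _ h)
      by_cases hpS : p ∈ S
      · exact Or.inl (Or.inl ⟨hpv, hpS⟩)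
      · exact Or.inr (hS p hpv hpS)
    · right
      rw [connectedComponentIn_eq hxC]
      exact (isPreconnected_arc_diff_right h).subset_connectedComponentIn
        ⟨left_mem_arc h, hxy⟩ (fun r hr hrS =>
          hr.2 (eq_right_of_mem_arc_of_mem_drawing_induce h hx hr.1 hrS).1) ⟨hp, hpy⟩
  intro p hp
  obtain hp | ⟨x, y, h, hp⟩ := mem_drawing_iff.1 hp
  · by_cases hpS : p ∈ S
    · exact Or.inl (Or.inl ⟨hp, hpS⟩)
    · exact Or.inr (hS p hp hpS)
  · by_cases hx : x ∈ S
    · by_cases hy : y ∈ S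
      · exact Or.inl (arc_subset_drawing (G := G.induce S) ⟨h, hx, hy⟩ hp)
      · exact key y x p (G.adj_symm x y h) hy (G.arc_symm x y ▸ hp)
    · exact key x y p h hx hp

/-- The component of the remaining plane containing a deleted external vertex is unbounded. -/
lemma ExternalVertex.not_isBounded_connectedComponentIn (hu : G.ExternalVertex u) (huS : u ∉ S) :
    ¬ Bornology.IsBounded (connectedComponentIn (G.induce S).drawingᶜ u) := by
  obtain ⟨huv, F, ⟨q, hq, rfl⟩, hunb, hcl⟩ := hu
  refine fun hb => hunb (hb.subset ?_)
  have hconn : IsPreconnected (insert u (connectedComponentIn G.drawingᶜ q)) :=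
    isPreconnected_connectedComponentIn.subset_closure (subset_insert _ _)
      (insert_subset hcl subset_closure)
  refine (subset_insert _ _).trans
    (hconn.subset_connectedComponentIn (mem_insert _ _) (insert_subset ?_ ?_))
  · exact fun h => huS (mem_of_mem_drawing_induce huv h)
  · exact (connectedComponentIn_subset _ _).trans (compl_subset_compl.2 drawing_induce_subset)

/-- A bounded face of an induced subgraph that misses the drawing of `G` is triangular
if all bounded faces of `G` are. -/
lemma isTriangularFace_induce
    (hG : ∀ F, G.IsFace F → Bornology.IsBounded F → G.IsTriangularFace F) {F : Set (ℝ × ℝ)}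
    (hF : (G.induce S).IsFace F) (hb : Bornology.IsBounded F) (hdis : F ⊆ G.drawingᶜ) :
    (G.induce S).IsTriangularFace F := by
  obtain ⟨q, hq, rfl⟩ := hF
  have hqF := mem_connectedComponentIn (mem_compl hq)
  have hface : G.IsFace (connectedComponentIn (G.induce S).drawingᶜ q) :=
    ⟨q, hdis hqF, (isPreconnected_connectedComponentIn.subset_connectedComponentIn hqF
      hdis).antisymm (connectedComponentIn_mono _ (compl_subset_compl.2 drawing_induce_subset))⟩
  obtain ⟨a, b, c, ⟨hab, hac, hbc, Aab, Abc, Aac⟩, hfr⟩ := hG _ hface hb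
  have hopen : IsOpen (connectedComponentIn (G.induce S).drawingᶜ q) :=
    (isClosed_drawing _).isOpen_compl.connectedComponentIn
  have hsub : frontier (connectedComponentIn (G.induce S).drawingᶜ q) ⊆
      (G.induce S).drawing := by
    intro p hp
    by_contra hpD
    rw [hopen.frontier_eq] at hp
    refine hp.2 ?_
    have hconn := (isPreconnected_connectedComponentIn (F := (G.induce S).drawingᶜ)
      (x := q)).subset_closure (subset_insert p _) (insert_subset hp.1 subset_closure)
    exact hconn.subset_connectedComponentIn (mem_insert_of_mem _ hqF)
      (insert_subset hpD (connectedComponentIn_subset _ _)) (mem_insert _ _)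
  rw [hfr] at hsub
  have ha := mem_of_mem_drawing_induce (G.adj_mem _ _ Aab)
    (hsub (Or.inl (Or.inl (left_mem_arc Aab))))
  have hb := mem_of_mem_drawing_induce (G.adj_mem _ _ Abc)
    (hsub (Or.inl (Or.inr (left_mem_arc Abc))))
  have hc := mem_of_mem_drawing_induce (G.adj_mem _ _ (G.adj_symm _ _ Abc))
    (hsub (Or.inl (Or.inr (right_mem_arc Abc))))
  exact ⟨a, b, c, ⟨hab, hac, hbc, ⟨Aab, ha, hb⟩, ⟨Abc, hb, hc⟩, ⟨Aac, ha, hc⟩⟩, hfr⟩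

lemma IsTriangle.rotate (h : G.IsTriangle a b c) : G.IsTriangle b c a :=
  ⟨h.2.2.1, h.1.symm, h.2.1.symm, h.2.2.2.2.1, G.adj_symm _ _ h.2.2.2.2.2,
    G.adj_symm _ _ h.2.2.2.1⟩

/-- If every vertex is in a triangle, then bad vertices are neighbours of `u`. -/
lemma IsBadFor.adj (hG : ∀ v ∈ G.verts, G.InTriangle v) (hx : G.IsBadFor u x) : G.Adj u x := by
  obtain ⟨hxv, hxu, hbad⟩ := hx
  obtain ⟨b, c, h⟩ := hG x hxv
  obtain ⟨h1, h2, h3, A1, A2, A3⟩ := h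
  by_cases hb : b = u
  · exact hb ▸ G.adj_symm _ _ A1
  by_cases hc : c = u
  · exact hc ▸ G.adj_symm _ _ A3
  exact absurd ⟨b, c, h1, h2, h3, ⟨A1, hxu, hb⟩, ⟨A2, hb, hc⟩, ⟨A3, hxu, hc⟩⟩ hbad

lemma inTriangle_delete_bad
    (hv : v ∈ (G.delete ({u} ∪ {x | G.IsBadFor u x})).verts) :
    (G.delete ({u} ∪ {x | G.IsBadFor u x})).InTriangle v := by
  have key : ∀ {a b c}, (G.erase u).IsTriangle a b c → a ∈ ({u} ∪ {x | G.IsBadFor u x})ᶜ := by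
    rintro a b c h (ha | ha)
    · exact h.2.2.2.1.2.1 ha
    · exact ha.2.2 ⟨b, c, h⟩
  obtain ⟨hvG, hvS⟩ := hv
  have htri : (G.erase u).InTriangle v :=
    by_contra fun h => hvS (Or.inr ⟨hvG, fun e => hvS (Or.inl e), h⟩)
  obtain ⟨b, c, h⟩ := htri
  have hb := key h.rotate
  have hc := key h.rotate.rotate
  obtain ⟨h1, h2, h3, A1, A2, A3⟩ := h
  exact ⟨b, c, h1, h2, h3, ⟨A1.1, hvS, hb⟩, ⟨A2.1, hb, hc⟩, ⟨A3.1, hvS, hc⟩⟩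

end PlaneGraph

open PlaneGraph in
/-- If `u` is a problematic external vertex of a weak near-triangulation `G` and `T`
is the set of all `u`-bad vertices of `G`, then `G − ({u} ∪ T)` is a weak
near-triangulation. -/
theorem WNT_delete_problematic_external (G : PlaneGraph) (hG : G.IsWNT)
    (u : ℝ × ℝ) (hu : G.ExternalVertex u) (hprob : G.Problematic u) :
    (G.delete ({u} ∪ {x | G.IsBadFor u x})).IsWNT := by
  refine ⟨fun F hF hb => isTriangularFace_induce hG.1 hF hb fun p hpF hpG => ?_,
    fun v hv => inTriangle_delete_bad hv⟩
  set S : Set (ℝ × ℝ) := ({u} ∪ {x | G.IsBadFor u x})ᶜ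
  have huS : u ∉ S := fun h => h (Or.inl rfl)
  have huC : u ∈ connectedComponentIn (G.induce S).drawingᶜ u :=
    mem_connectedComponentIn fun h => huS (mem_of_mem_drawing_induce hu.1 h)
  have hdel : ∀ x ∈ G.verts, x ∉ S → x ∈ connectedComponentIn (G.induce S).drawingᶜ u := by
    intro x _ hx
    obtain rfl | hbad := not_not.1 hx
    · exact huC
    · have hux := hbad.adj hG.2
      exact (isPreconnected_arc hux).subset_connectedComponentIn (left_mem_arc hux)
        (fun r hr hrS => hx (eq_right_of_mem_arc_of_mem_drawing_induce hux huS hr hrS).2)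
        (right_mem_arc hux)
  obtain ⟨q, -, rfl⟩ := hF
  obtain hp | hp := drawing_subset_union_face hdel hpG
  · exact connectedComponentIn_subset _ _ hpF hp
  · refine hu.not_isBounded_connectedComponentIn huS ?_
    exact ((connectedComponentIn_eq hp).trans (connectedComponentIn_eq hpF).symm) ▸ hb
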